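/- Suppose p satisfies Y ⊥ A | (Z,C). Then Var_p(φ_bdtd) = Var_p(φ_td) + Σ_{z,c} (p(z|a⋆,c) − p(z|a°,c))²·p(c)·var(Y|z,c)·(1/(Σ_ā p(z|ā,c)·p(ā|c)) − Σ_ā p(ā|c)/p(z|ā,c)). -/

import Mathlib

open Finset

noncomputable section

namespace TwoDoorPaper

/-- Indicator 1[a = b] as a real number. -/
def ind {A : Type*} [DecidableEq A] (a b : A) : ℝ := if a = b then 1 else 0

variable {C A Z Y : Type*} [Fintype C] [Fintype A] [Fintype Z] [Fintype Y]

/-- Marginal p(c). -/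
def pC (p : C → A → Z → Y → ℝ) (c : C) : ℝ := ∑ a, ∑ z, ∑ y, p c a z y

/-- Marginal p(a,c). -/
def pAC (p : C → A → Z → Y → ℝ) (a : A) (c : C) : ℝ := ∑ z, ∑ y, p c a z y

/-- Marginal p(c,a,z). -/
def pCAZ (p : C → A → Z → Y → ℝ) (c : C) (a : A) (z : Z) : ℝ := ∑ y, p c a z y

/-- Marginal p(a). -/
def pA (p : C → A → Z → Y → ℝ) (a : A) : ℝ := ∑ c, pAC p a c

/-- Marginal p(a,z). -/
def pAZ (p : C → A → Z → Y → ℝ) (a : A) (z : Z) : ℝ := ∑ c, pCAZ p c a z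

/-- Marginal p(z,c). -/
def pZC (p : C → A → Z → Y → ℝ) (z : Z) (c : C) : ℝ := ∑ a, pCAZ p c a z

/-- Conditional p(a|c). -/
def cA (p : C → A → Z → Y → ℝ) (a : A) (c : C) : ℝ := pAC p a c / pC p c

/-- Conditional p(z|a,c). -/
def cZ (p : C → A → Z → Y → ℝ) (z : Z) (a : A) (c : C) : ℝ := pCAZ p c a z / pAC p a c

/-- Conditional p(z|a). -/
def cZA (p : C → A → Z → Y → ℝ) (z : Z) (a : A) : ℝ := pAZ p a z / pA p a

/-- Conditional p(y|a,z,c). -/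
def cY (p : C → A → Z → Y → ℝ) (a : A) (z : Z) (c : C) (y : Y) : ℝ := p c a z y / pCAZ p c a z

/-- Conditional p(y|a,z). -/
def cYaz (p : C → A → Z → Y → ℝ) (a : A) (z : Z) (y : Y) : ℝ := (∑ c, p c a z y) / pAZ p a z

/-- Conditional p(y|a,c). -/
def cYac (p : C → A → Z → Y → ℝ) (a : A) (c : C) (y : Y) : ℝ := (∑ z, p c a z y) / pAC p a c

/-- Conditional p(y|z,c). -/
def cYzc (p : C → A → Z → Y → ℝ) (z : Z) (c : C) (y : Y) : ℝ := (∑ a, p c a z y) / pZC p z c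

/-- Conditional expectation E(Y|a,z,c). -/
def EYazc (p : C → A → Z → Y → ℝ) (yv : Y → ℝ) (a : A) (z : Z) (c : C) : ℝ :=
  ∑ y, yv y * cY p a z c y

/-- Conditional variance var(Y|a,z,c). -/
def VYazc (p : C → A → Z → Y → ℝ) (yv : Y → ℝ) (a : A) (z : Z) (c : C) : ℝ :=
  (∑ y, (yv y) ^ 2 * cY p a z c y) - (EYazc p yv a z c) ^ 2

/-- Conditional expectation E(Y|a,z). -/
def EYaz (p : C → A → Z → Y → ℝ) (yv : Y → ℝ) (a : A) (z : Z) : ℝ :=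
  ∑ y, yv y * cYaz p a z y

/-- Conditional variance var(Y|a,z). -/
def VYaz (p : C → A → Z → Y → ℝ) (yv : Y → ℝ) (a : A) (z : Z) : ℝ :=
  (∑ y, (yv y) ^ 2 * cYaz p a z y) - (EYaz p yv a z) ^ 2

/-- Conditional expectation E(Y|a,c). -/
def EYac (p : C → A → Z → Y → ℝ) (yv : Y → ℝ) (a : A) (c : C) : ℝ :=
  ∑ y, yv y * cYac p a c y

/-- Conditional expectation E(Y|z,c). -/
def EYzc (p : C → A → Z → Y → ℝ) (yv : Y → ℝ) (z : Z) (c : C) : ℝ :=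
  ∑ y, yv y * cYzc p z c y

/-- Conditional variance var(Y|z,c). -/
def VYzc (p : C → A → Z → Y → ℝ) (yv : Y → ℝ) (z : Z) (c : C) : ℝ :=
  (∑ y, (yv y) ^ 2 * cYzc p z c y) - (EYzc p yv z c) ^ 2

/-- var(C|a) for real-valued covariates. -/
def VCgivenA (p : C → A → Z → Y → ℝ) (cv : C → ℝ) (a : A) : ℝ :=
  (∑ c, (cv c) ^ 2 * (pAC p a c / pA p a)) - (∑ c, cv c * (pAC p a c / pA p a)) ^ 2

/-- var(Z|a) for real-valued mediators. -/
def VZgivenA (p : C → A → Z → Y → ℝ) (zv : Z → ℝ) (a : A) : ℝ :=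
  (∑ z, (zv z) ^ 2 * cZA p z a) - (∑ z, zv z * cZA p z a) ^ 2

/-- Expectation of f under p. -/
def Ep (p : C → A → Z → Y → ℝ) (f : C → A → Z → Y → ℝ) : ℝ :=
  ∑ c, ∑ a, ∑ z, ∑ y, p c a z y * f c a z y

/-- Variance of f under p. -/
def Varp (p : C → A → Z → Y → ℝ) (f : C → A → Z → Y → ℝ) : ℝ :=
  (∑ c, ∑ a, ∑ z, ∑ y, p c a z y * (f c a z y) ^ 2) - (Ep p f) ^ 2

/-- p is a strictly positive probability mass function. -/
def IsPMF (p : C → A → Z → Y → ℝ) : Prop :=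
  (∀ c a z y, 0 < p c a z y) ∧ (∑ c, ∑ a, ∑ z, ∑ y, p c a z y) = 1

/-- Y ⊥ A | (Z, C): p(y|a,z,c) does not depend on a. -/
def IndepYA (p : C → A → Z → Y → ℝ) : Prop :=
  ∀ a a' z c y, cY p a z c y = cY p a' z c y

/-- Z ⊥ C | A: p(z|a,c) = p(z|a) for all c. -/
def IndepZC (p : C → A → Z → Y → ℝ) : Prop :=
  ∀ z a c, cZ p z a c = cZA p z a

/-- θ_td. -/
def thTD (p : C → A → Z → Y → ℝ) (yv : Y → ℝ) (astar acirc : A) : ℝ :=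
  ∑ z, ∑ c, ∑ ab, EYazc p yv ab z c * (cZ p z astar c - cZ p z acirc c) * cA p ab c * pC p c

/-- The two-door efficient influence function φ_td. -/
def phiTD [DecidableEq A] (p : C → A → Z → Y → ℝ) (yv : Y → ℝ) (astar acirc : A)
    (c : C) (a : A) (z : Z) (y : Y) : ℝ :=
  (yv y - EYazc p yv a z c) * (cZ p z astar c - cZ p z acirc c) / cZ p z a c
  + ((∑ ab, EYazc p yv ab z c * cA p ab c)
      - ∑ ab, ∑ z', EYazc p yv ab z' c * cZ p z' a c * cA p ab c)
    * (ind a astar - ind a acirc) / cA p a c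
  + (∑ z', EYazc p yv a z' c * (cZ p z' astar c - cZ p z' acirc c))
  - thTD p yv astar acirc

/-- θ_bd. -/
def thBD (p : C → A → Z → Y → ℝ) (yv : Y → ℝ) (astar acirc : A) : ℝ :=
  ∑ c, pC p c * (EYac p yv astar c - EYac p yv acirc c)

/-- The back-door efficient influence function φ_bd. -/
def phiBD [DecidableEq A] (p : C → A → Z → Y → ℝ) (yv : Y → ℝ) (astar acirc : A)
    (c : C) (a : A) (_z : Z) (y : Y) : ℝ :=
  ind a astar * (yv y - EYac p yv astar c) / cA p astar c
  - ind a acirc * (yv y - EYac p yv acirc c) / cA p acirc c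
  + EYac p yv astar c - EYac p yv acirc c - thBD p yv astar acirc

/-- θ° (for the combined back-door/two-door model). -/
def thBDTD (p : C → A → Z → Y → ℝ) (yv : Y → ℝ) (astar acirc : A) : ℝ :=
  ∑ z, ∑ c, EYzc p yv z c * (cZ p z astar c - cZ p z acirc c) * pC p c

/-- The efficient influence function φ_bdtd. -/
def phiBDTD [DecidableEq A] (p : C → A → Z → Y → ℝ) (yv : Y → ℝ) (astar acirc : A)
    (c : C) (a : A) (z : Z) (y : Y) : ℝ :=
  (yv y - EYzc p yv z c) * (cZ p z astar c - cZ p z acirc c) / (∑ ab, cZ p z ab c * cA p ab c)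
  + (EYzc p yv z c - ∑ z', EYzc p yv z' c * cZ p z' a c)
    * (ind a astar - ind a acirc) / cA p a c
  + (∑ z', EYzc p yv z' c * (cZ p z' astar c - cZ p z' acirc c))
  - thBDTD p yv astar acirc

/-- ψ_fd(ă). -/
def psiFD (p : C → A → Z → Y → ℝ) (yv : Y → ℝ) (abreve : A) : ℝ :=
  ∑ z, ∑ ab, EYaz p yv ab z * pA p ab * cZA p z abreve

/-- θ_fd. -/
def thFD (p : C → A → Z → Y → ℝ) (yv : Y → ℝ) (astar acirc : A) : ℝ :=
  psiFD p yv astar - psiFD p yv acirc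

/-- The front-door efficient influence function φ_fd. -/
def phiFD [DecidableEq A] (p : C → A → Z → Y → ℝ) (yv : Y → ℝ) (astar acirc : A)
    (_c : C) (a : A) (z : Z) (y : Y) : ℝ :=
  (yv y - EYaz p yv a z) * (cZA p z astar - cZA p z acirc) / cZA p z a
  + ind a astar * ((∑ ab, EYaz p yv ab z * pA p ab) - psiFD p yv astar) / pA p astar
  - ind a acirc * ((∑ ab, EYaz p yv ab z * pA p ab) - psiFD p yv acirc) / pA p acirc
  + (∑ z', EYaz p yv a z' * (cZA p z' astar - cZA p z' acirc))
  - thFD p yv astar acirc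

/-- θ' (for the combined front-door/two-door model). -/
def thFDTD (p : C → A → Z → Y → ℝ) (yv : Y → ℝ) (astar acirc : A) : ℝ :=
  ∑ c, ∑ ab, ∑ z, EYazc p yv ab z c * (cZA p z astar - cZA p z acirc) * cA p ab c * pC p c

/-- The efficient influence function φ_fdtd. -/
def phiFDTD [DecidableEq A] (p : C → A → Z → Y → ℝ) (yv : Y → ℝ) (astar acirc : A)
    (c : C) (a : A) (z : Z) (y : Y) : ℝ :=
  (yv y - EYazc p yv a z c) * (cZA p z astar - cZA p z acirc) / cZA p z a
  + (∑ c', ((∑ ab, EYazc p yv ab z c' * cA p ab c')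
        - ∑ ab, ∑ z', EYazc p yv ab z' c' * cZA p z' a * cA p ab c') * pC p c')
    * (ind a astar - ind a acirc) / pA p a
  + (∑ z', EYazc p yv a z' c * (cZA p z' astar - cZA p z' acirc))
  - thFDTD p yv astar acirc

/-- θ'' (for the combined back/front/two-door model). -/
def thBDFDTD (p : C → A → Z → Y → ℝ) (yv : Y → ℝ) (astar acirc : A) : ℝ :=
  ∑ c, ∑ z, EYzc p yv z c * (cZA p z astar - cZA p z acirc) * pC p c

/-- The efficient influence function φ_bdfdtd. -/
def phiBDFDTD [DecidableEq A] (p : C → A → Z → Y → ℝ) (yv : Y → ℝ) (astar acirc : A)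
    (c : C) (a : A) (z : Z) (y : Y) : ℝ :=
  (yv y - EYzc p yv z c) * (cZA p z astar - cZA p z acirc) / (∑ ab, cA p ab c * cZA p z ab)
  + (∑ c', (EYzc p yv z c' - ∑ z', EYzc p yv z' c' * cZA p z' a) * pC p c')
    * (ind a astar - ind a acirc) / (∑ c', pC p c' * cA p a c')
  + (∑ z', EYzc p yv z' c * (cZA p z' astar - cZA p z' acirc))
  - thBDFDTD p yv astar acirc

set_option linter.unusedSectionVars false

section Marginals

variable {p : C → A → Z → Y → ℝ}

lemma pCAZ_pos [Nonempty Y] (hpos : ∀ c a z y, 0 < p c a z y) (c : C) (a : A) (z : Z) :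
    0 < pCAZ p c a z :=
  sum_pos (fun y _ => hpos c a z y) univ_nonempty

lemma pAC_pos [Nonempty Z] [Nonempty Y] (hpos : ∀ c a z y, 0 < p c a z y) (a : A) (c : C) :
    0 < pAC p a c :=
  sum_pos (fun z _ => pCAZ_pos hpos c a z) univ_nonempty

lemma pC_pos [Nonempty A] [Nonempty Z] [Nonempty Y] (hpos : ∀ c a z y, 0 < p c a z y) (c : C) :
    0 < pC p c :=
  sum_pos (fun a _ => pAC_pos hpos a c) univ_nonempty

lemma pZC_pos [Nonempty A] [Nonempty Y] (hpos : ∀ c a z y, 0 < p c a z y) (z : Z) (c : C) :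
    0 < pZC p z c :=
  sum_pos (fun a _ => pCAZ_pos hpos c a z) univ_nonempty

lemma sum_cA [Nonempty A] [Nonempty Z] [Nonempty Y] (hpos : ∀ c a z y, 0 < p c a z y) (c : C) :
    ∑ a, cA p a c = 1 := by
  unfold cA
  rw [← sum_div]
  exact div_self (pC_pos hpos c).ne'

lemma sum_cZ_mul_cA [Nonempty Z] [Nonempty Y] (hpos : ∀ c a z y, 0 < p c a z y) (z : Z) (c : C) :
    ∑ a, cZ p z a c * cA p a c = pZC p z c / pC p c := by
  unfold pZC
  rw [sum_div]
  refine sum_congr rfl fun a _ => ?_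
  have := (pAC_pos hpos a c).ne'
  unfold cZ cA
  field_simp

end Marginals

section Independence

variable {p : C → A → Z → Y → ℝ} [Nonempty Y]

lemma cYzc_eq_cY [Nonempty A] (hpos : ∀ c a z y, 0 < p c a z y) (hind : IndepYA p)
    (a : A) (z : Z) (c : C) (y : Y) : cYzc p z c y = cY p a z c y := by
  unfold cYzc
  rw [div_eq_iff (pZC_pos hpos z c).ne', pZC, mul_sum]
  refine sum_congr rfl fun b _ => ?_
  rw [hind a b z c y, cY, div_mul_cancel₀ _ (pCAZ_pos hpos c b z).ne']

lemma EYazc_eq_EYzc [Nonempty A] (hpos : ∀ c a z y, 0 < p c a z y) (hind : IndepYA p)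
    (yv : Y → ℝ) (a : A) (z : Z) (c : C) : EYazc p yv a z c = EYzc p yv z c := by
  simp only [EYazc, EYzc, cYzc_eq_cY hpos hind a]

lemma VYazc_eq_VYzc [Nonempty A] (hpos : ∀ c a z y, 0 < p c a z y) (hind : IndepYA p)
    (yv : Y → ℝ) (a : A) (z : Z) (c : C) : VYazc p yv a z c = VYzc p yv z c := by
  simp only [VYazc, VYzc, EYazc_eq_EYzc hpos hind, cYzc_eq_cY hpos hind a]

end Independence

section ResidualForm

variable {p : C → A → Z → Y → ℝ} [Nonempty Y]

lemma sum_mul_eq_pCAZ_mul_EYazc (hpos : ∀ c a z y, 0 < p c a z y) (yv : Y → ℝ)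
    (c : C) (a : A) (z : Z) :
    ∑ y, p c a z y * yv y = pCAZ p c a z * EYazc p yv a z c := by
  rw [EYazc, mul_sum]
  refine sum_congr rfl fun y _ => ?_
  have := (pCAZ_pos hpos c a z).ne'
  unfold cY
  field_simp

lemma sum_mul_sq_eq_pCAZ_mul (hpos : ∀ c a z y, 0 < p c a z y) (yv : Y → ℝ)
    (c : C) (a : A) (z : Z) :
    ∑ y, p c a z y * yv y ^ 2 = pCAZ p c a z * (VYazc p yv a z c + EYazc p yv a z c ^ 2) := by
  rw [VYazc, sub_add_cancel]
  exact sum_mul_eq_pCAZ_mul_EYazc hpos (fun y => yv y ^ 2) c a z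

lemma sum_mul_residual_add (hpos : ∀ c a z y, 0 < p c a z y) (yv : Y → ℝ) (k w : ℝ)
    (c : C) (a : A) (z : Z) :
    ∑ y, p c a z y * ((yv y - EYazc p yv a z c) * k + w) = pCAZ p c a z * w := by
  have h : ∀ y, p c a z y * ((yv y - EYazc p yv a z c) * k + w)
      = p c a z y * yv y * k + p c a z y * (w - EYazc p yv a z c * k) := fun y => by ring
  simp only [h, sum_add_distrib, ← sum_mul]
  rw [sum_mul_eq_pCAZ_mul_EYazc hpos yv, ← pCAZ]
  ring

lemma sum_mul_residual_add_sq (hpos : ∀ c a z y, 0 < p c a z y) (yv : Y → ℝ) (k w : ℝ)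
    (c : C) (a : A) (z : Z) :
    ∑ y, p c a z y * ((yv y - EYazc p yv a z c) * k + w) ^ 2
      = pCAZ p c a z * (VYazc p yv a z c * k ^ 2 + w ^ 2) := by
  have h : ∀ y, p c a z y * ((yv y - EYazc p yv a z c) * k + w) ^ 2
      = p c a z y * yv y ^ 2 * k ^ 2
        + p c a z y * yv y * (2 * k * (w - EYazc p yv a z c * k))
        + p c a z y * (w - EYazc p yv a z c * k) ^ 2 := fun y => by ring
  simp only [h, sum_add_distrib, ← sum_mul]
  rw [sum_mul_eq_pCAZ_mul_EYazc hpos yv, sum_mul_sq_eq_pCAZ_mul hpos, ← pCAZ]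
  ring

/-- The part of the variance due to the outcome residual is additive. -/
lemma Varp_residual_add (hpos : ∀ c a z y, 0 < p c a z y) (yv : Y → ℝ) (k w : C → A → Z → ℝ) :
    Varp p (fun c a z y => (yv y - EYazc p yv a z c) * k c a z + w c a z)
      = (∑ c, ∑ a, ∑ z, pCAZ p c a z * VYazc p yv a z c * k c a z ^ 2)
        + ((∑ c, ∑ a, ∑ z, pCAZ p c a z * w c a z ^ 2)
          - (∑ c, ∑ a, ∑ z, pCAZ p c a z * w c a z) ^ 2) := by
  simp only [Varp, Ep, sum_mul_residual_add hpos, sum_mul_residual_add_sq hpos]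
  simp only [mul_add, sum_add_distrib, ← mul_assoc]
  ring

end ResidualForm

/-- The part of `phiBDTD` that does not involve the outcome. -/
def outcomeFreePart [DecidableEq A] (p : C → A → Z → Y → ℝ) (yv : Y → ℝ) (astar acirc : A)
    (c : C) (a : A) (z : Z) : ℝ :=
  (EYzc p yv z c - ∑ z', EYzc p yv z' c * cZ p z' a c) * (ind a astar - ind a acirc) / cA p a c
  + (∑ z', EYzc p yv z' c * (cZ p z' astar c - cZ p z' acirc c))
  - thBDTD p yv astar acirc

section InfluenceFunctions

variable {p : C → A → Z → Y → ℝ} [Nonempty A] [Nonempty Z] [Nonempty Y]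

lemma thTD_eq_thBDTD (hpos : ∀ c a z y, 0 < p c a z y) (hind : IndepYA p) (yv : Y → ℝ)
    (astar acirc : A) : thTD p yv astar acirc = thBDTD p yv astar acirc := by
  simp only [thTD, thBDTD, EYazc_eq_EYzc hpos hind, ← sum_mul, ← mul_sum, sum_cA hpos, mul_one]

lemma phiTD_eq_residual_add [DecidableEq A] (hpos : ∀ c a z y, 0 < p c a z y)
    (hind : IndepYA p) (yv : Y → ℝ) (astar acirc : A) :
    phiTD p yv astar acirc = fun c a z y =>
      (yv y - EYazc p yv a z c) * ((cZ p z astar c - cZ p z acirc c) / cZ p z a c)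
        + outcomeFreePart p yv astar acirc c a z := by
  funext c a z y
  simp only [phiTD, outcomeFreePart, thTD_eq_thBDTD hpos hind, EYazc_eq_EYzc hpos hind,
    ← sum_mul, ← mul_sum, sum_cA hpos, mul_one]
  ring

lemma phiBDTD_eq_residual_add [DecidableEq A] (hpos : ∀ c a z y, 0 < p c a z y)
    (hind : IndepYA p) (yv : Y → ℝ) (astar acirc : A) :
    phiBDTD p yv astar acirc = fun c a z y =>
      (yv y - EYazc p yv a z c)
          * ((cZ p z astar c - cZ p z acirc c) / ∑ ab, cZ p z ab c * cA p ab c)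
        + outcomeFreePart p yv astar acirc c a z := by
  funext c a z y
  simp only [phiBDTD, outcomeFreePart, EYazc_eq_EYzc hpos hind]
  ring

lemma sum_pCAZ_div_mixture_sq (hpos : ∀ c a z y, 0 < p c a z y) (v d : ℝ) (z : Z) (c : C) :
    ∑ a, pCAZ p c a z * v * (d / ∑ ab, cZ p z ab c * cA p ab c) ^ 2
      = d ^ 2 * pC p c * v * (1 / ∑ ab, cZ p z ab c * cA p ab c) := by
  have hC := (pC_pos hpos c).ne'
  have hZ := (pZC_pos hpos z c).ne'
  rw [← sum_mul, ← sum_mul, ← pZC, sum_cZ_mul_cA hpos]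
  field_simp

lemma sum_pCAZ_div_cZ_sq (hpos : ∀ c a z y, 0 < p c a z y) (v d : ℝ) (z : Z) (c : C) :
    ∑ a, pCAZ p c a z * v * (d / cZ p z a c) ^ 2
      = d ^ 2 * pC p c * v * ∑ a, cA p a c / cZ p z a c := by
  rw [mul_sum]
  refine sum_congr rfl fun a _ => ?_
  have hC := (pC_pos hpos c).ne'
  have hA := (pAC_pos hpos a c).ne'
  have hZ := (pCAZ_pos hpos c a z).ne'
  unfold cA cZ
  field_simp

end InfluenceFunctions

lemma sum_comm_cycle (f : C → A → Z → ℝ) : ∑ c, ∑ a, ∑ z, f c a z = ∑ z, ∑ c, ∑ a, f c a z := by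
  rw [sum_comm (s := (univ : Finset Z))]
  exact sum_congr rfl fun c _ => sum_comm

/-- Proposition 3 (first part): variance of φ_bdtd versus φ_td under Y ⊥ A | (Z,C). -/
theorem stmt6
    {C A Z Y : Type*} [Fintype C] [Fintype A] [Fintype Z] [Fintype Y]
    [Nonempty C] [Nonempty A] [Nonempty Z] [Nonempty Y] [DecidableEq A]
    (p : C → A → Z → Y → ℝ) (yv : Y → ℝ) (hyv : Function.Injective yv)
    (hp : IsPMF p) (astar acirc : A) (hne : astar ≠ acirc)
    (hind : IndepYA p) :
    Varp p (phiBDTD p yv astar acirc) =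
      Varp p (phiTD p yv astar acirc)
        + ∑ z, ∑ c, (cZ p z astar c - cZ p z acirc c) ^ 2 * pC p c * VYzc p yv z c *
            (1 / (∑ ab, cZ p z ab c * cA p ab c) - ∑ ab, cA p ab c / cZ p z ab c) := by
  have hpos := hp.1
  rw [phiTD_eq_residual_add hpos hind, phiBDTD_eq_residual_add hpos hind,
    Varp_residual_add hpos, Varp_residual_add hpos]
  simp only [VYazc_eq_VYzc hpos hind]
  rw [sum_comm_cycle fun c a z => pCAZ p c a z * VYzc p yv z c * (_ / ∑ ab, _) ^ 2,
    sum_comm_cycle fun c a z => pCAZ p c a z * VYzc p yv z c * (_ / cZ p z a c) ^ 2]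
  simp only [sum_pCAZ_div_mixture_sq hpos, sum_pCAZ_div_cZ_sq hpos, mul_sub, sum_sub_distrib]
  ring

end TwoDoorPaper
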